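/- arXiv:1310.6008 — 6 statements merged into one kernel-verified Lean document; each statement's English description precedes it below -/
import Mathlib

section
/- Let A = {0,1} and n ≥ 4. For every l with 3 ≤ l ≤ n−1, the subgroup of Sym(A^n) generated by all l-ary instructions is exactly the alternating group Alt(A^n). -/
/-- An *`l`-ary instruction* on `A^n` is a permutation of `Fin n → A` which
changes at most one coordinate `j`, the new value of that coordinate
depending on at most `l` of the registers. -/
def IsLAryInstruction {n : ℕ} {A : Type*} (l : ℕ)
    (g : Equiv.Perm (Fin n → A)) : Prop :=
  ∃ j : Fin n, (∀ (x : Fin n → A) (i : Fin n), i ≠ j → g x i = x i) ∧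
    ∃ S : Finset (Fin n), S.card ≤ l ∧
      ∀ x y : Fin n → A, (∀ i ∈ S, x i = y i) → g x j = g y j

open Equiv Equiv.Perm in
/-- If two involutions move exactly one common point, the square of their product is a
three-cycle. -/
theorem isThreeCycle_of_involutive_of_unique_common_moved_point {α : Type*} [Fintype α]
    [DecidableEq α] {a b : Perm α} (ha : ∀ x, a (a x) = x) (hb : ∀ x, b (b x) = x) {p : α}
    (hab : ∀ x, a x ≠ x → b x ≠ x → x = p) (hap : a p ≠ p) (hbp : b p ≠ p) :
    IsThreeCycle (a * b * a * b) := by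
  have haq : b (a p) = a p := by grind
  have har : a (b p) = b p := by grind
  have hqr : a p ≠ b p := by grind
  have key : a * b * a * b = swap (a p) p * swap (a p) (b p) := by
    ext1 x
    simp only [Perm.mul_apply]
    by_cases h1 : x = p
    · rw [h1, swap_apply_of_ne_of_ne hap.symm hbp.symm, swap_apply_right, har, hb]
    by_cases h2 : x = a p
    · rw [h2, swap_apply_left, swap_apply_of_ne_of_ne hqr.symm hbp, haq, ha, har]
    by_cases h3 : x = b p
    · rw [h3, swap_apply_right, swap_apply_left, hb, haq, ha]
    rw [swap_apply_of_ne_of_ne h2 h3, swap_apply_of_ne_of_ne h2 h1]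
    by_cases hx : a x = x
    · by_cases hx' : b x = x
      · grind
      · have : a (b x) = b x := by grind
        grind
    · have : b x = x := by grind
      have : b (a x) = a x := by grind
      grind
  rw [key]
  exact isThreeCycle_swap_mul_swap_same hap hqr hbp.symm

namespace Register

variable {n : ℕ}

theorem fin_two_add_one_add_one (a : Fin 2) : a + 1 + 1 = a := by
  revert a; decide

theorem fin_two_add_one_ne (a : Fin 2) : a + 1 ≠ a := by
  revert a; decide

open Classical in
/-- Flip register `t` when all the registers of `S` other than `t` hold `1`. -/
noncomputable def controlledFlip (t : Fin n) (S : Finset (Fin n)) (x : Fin n → Fin 2) :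
    Fin n → Fin 2 :=
  fun i => if i = t ∧ ∀ k ∈ S, k ≠ t → x k = 1 then x i + 1 else x i

theorem controlledFlip_of_ne {t i : Fin n} (S : Finset (Fin n)) (x : Fin n → Fin 2)
    (h : i ≠ t) : controlledFlip t S x i = x i := by
  simp [controlledFlip, h]

theorem controlledFlip_involutive (t : Fin n) (S : Finset (Fin n)) :
    Function.Involutive (controlledFlip t S) := by
  intro x
  have hc : (∀ k ∈ S, k ≠ t → controlledFlip t S x k = 1) ↔ ∀ k ∈ S, k ≠ t → x k = 1 := by
    refine forall₃_congr fun k _ hk => ?_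
    rw [controlledFlip_of_ne S x hk]
  funext i
  by_cases hi : i = t
  · subst hi
    by_cases h : ∀ k ∈ S, k ≠ i → x k = 1
    · rw [controlledFlip, if_pos ⟨rfl, hc.2 h⟩, controlledFlip, if_pos ⟨rfl, h⟩,
        fin_two_add_one_add_one]
    · rw [controlledFlip, if_neg (fun h' => h (hc.1 h'.2)), controlledFlip,
        if_neg (fun h' => h h'.2)]
  · rw [controlledFlip_of_ne _ _ hi, controlledFlip_of_ne _ _ hi]

/-- `controlledFlip` as a permutation of the states. -/
noncomputable def controlledFlipPerm (t : Fin n) (S : Finset (Fin n)) :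
    Equiv.Perm (Fin n → Fin 2) :=
  (controlledFlip_involutive t S).toPerm

theorem controlledFlipPerm_apply (t : Fin n) (S : Finset (Fin n)) (x : Fin n → Fin 2) :
    controlledFlipPerm t S x = controlledFlip t S x := rfl

theorem controlledFlip_ne_self_iff {t : Fin n} {S : Finset (Fin n)} {x : Fin n → Fin 2} :
    controlledFlip t S x ≠ x ↔ ∀ k ∈ S, k ≠ t → x k = 1 := by
  constructor
  · intro h
    by_contra hc
    exact h (funext fun i => by rw [controlledFlip, if_neg (fun h' => hc h'.2)])
  · intro h hx
    have := congrFun hx t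
    rw [controlledFlip, if_pos ⟨rfl, h⟩] at this
    exact fin_two_add_one_ne _ this

theorem isLAryInstruction_controlledFlipPerm {l : ℕ} (t : Fin n) {S : Finset (Fin n)}
    (hS : S.card < l) : IsLAryInstruction l (controlledFlipPerm t S) := by
  classical
  refine ⟨t, fun x i hi => controlledFlip_of_ne S x hi, insert t S,
    (Finset.card_insert_le _ _).trans hS, fun x y h => ?_⟩
  have hc : (∀ k ∈ S, k ≠ t → x k = 1) ↔ ∀ k ∈ S, k ≠ t → y k = 1 :=
    forall₃_congr fun k hk _ => by rw [h k (Finset.mem_insert_of_mem hk)]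
  simp only [controlledFlipPerm_apply, controlledFlip, hc, h t (Finset.mem_insert_self _ _)]

theorem controlledFlipPerm_insert {t u a : Fin n} {S : Finset (Fin n)} (hut : u ≠ t)
    (hat : a ≠ t) (hau : a ≠ u) (htS : t ∉ S) (huS : u ∉ S) :
    controlledFlipPerm t (insert a S) =
      controlledFlipPerm u S * controlledFlipPerm t {u, a} * controlledFlipPerm u S *
        controlledFlipPerm t {u, a} := by
  have hu : ∀ x : Fin n → Fin 2, (∀ k ∈ S, k ≠ u → x k = 1) ↔ ∀ k ∈ S, x k = 1 := by grind
  have ht : ∀ x : Fin n → Fin 2, (∀ k ∈ ({u, a} : Finset (Fin n)), k ≠ t → x k = 1) ↔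
      x u = 1 ∧ x a = 1 := by grind
  have hi : ∀ x : Fin n → Fin 2, (∀ k ∈ insert a S, k ≠ t → x k = 1) ↔
      x a = 1 ∧ ∀ k ∈ S, x k = 1 := by grind
  have hS : ∀ (v : Fin n) (T : Finset (Fin n)), v ∉ S → ∀ x : Fin n → Fin 2,
      (∀ k ∈ S, controlledFlip v T x k = 1) ↔ ∀ k ∈ S, x k = 1 := fun v T hv x =>
    forall₂_congr fun k hk => by rw [controlledFlip_of_ne _ _ (ne_of_mem_of_not_mem hk hv)]
  have fu : ∀ x, controlledFlip u S x u = if ∀ k ∈ S, x k = 1 then x u + 1 else x u :=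
    fun x => by simp only [controlledFlip, hu, true_and]
  have ft : ∀ x, controlledFlip t {u, a} x t = if x u = 1 ∧ x a = 1 then x t + 1 else x t :=
    fun x => by simp only [controlledFlip, ht, true_and]
  have fi : ∀ x, controlledFlip t (insert a S) x t =
      if x a = 1 ∧ ∀ k ∈ S, x k = 1 then x t + 1 else x t :=
    fun x => by simp only [controlledFlip, hi, true_and]
  have fin2 : ∀ c : Fin 2, c ≠ 1 ↔ c + 1 = 1 := by decide
  ext1 x
  simp only [Equiv.Perm.mul_apply, controlledFlipPerm_apply]
  funext i
  by_cases hiu : i = u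
  · subst hiu
    simp only [fu, hS _ _ htS, hS _ _ huS, controlledFlip_of_ne _ _ hut]
    split_ifs <;> simp [fin_two_add_one_add_one]
  by_cases hit : i = t
  · subst hit
    simp only [fi, ft, fu, hS _ _ htS, controlledFlip_of_ne _ _ hut, controlledFlip_of_ne _ _ hat,
      controlledFlip_of_ne _ _ hau, controlledFlip_of_ne _ _ hut.symm]
    by_cases h2 : ∀ k ∈ S, x k = 1
    · simp only [eq_true h2, and_true, if_true, ← fin2]
      by_cases h1 : x a = 1 <;> by_cases h3 : x u = 1 <;>
        simp [h1, h3]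
    · simp only [eq_false h2, and_false, if_false]
      by_cases h1 : x a = 1 <;> by_cases h3 : x u = 1 <;>
        simp [h1, h3, fin_two_add_one_add_one]
  · simp only [controlledFlip_of_ne _ _ hiu, controlledFlip_of_ne _ _ hit]

theorem controlledFlipPerm_mem {G : Subgroup (Equiv.Perm (Fin n → Fin 2))}
    (hG : ∀ g, IsLAryInstruction 3 g → g ∈ G) (m : ℕ) :
    ∀ (t : Fin n) (S : Finset (Fin n)), t ∉ S → S.card = m → m + 2 ≤ n →
      controlledFlipPerm t S ∈ G := by
  classical
  induction m with
  | zero => exact fun t S _ hS _ => hG _ (isLAryInstruction_controlledFlipPerm t (by omega))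
  | succ m ih =>
    intro t S htS hS hm
    obtain ⟨a, ha⟩ : S.Nonempty := Finset.card_pos.1 (by omega)
    obtain ⟨u, hu⟩ : ∃ u, u ∉ insert t S := by
      by_contra! h
      have h1 := Finset.card_insert_le t S
      rw [Finset.eq_univ_iff_forall.2 h, Finset.card_univ, Fintype.card_fin] at h1
      omega
    simp only [Finset.mem_insert, not_or] at hu
    have huS : u ∉ S.erase a := fun h => hu.2 (Finset.mem_of_mem_erase h)
    have hc : controlledFlipPerm u (S.erase a) ∈ G :=
      ih u _ huS (by rw [Finset.card_erase_of_mem ha]; omega) (by omega)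
    have hd : controlledFlipPerm t {u, a} ∈ G :=
      hG _ (isLAryInstruction_controlledFlipPerm t (Finset.card_le_two.trans_lt (by norm_num)))
    rw [← Finset.insert_erase ha, controlledFlipPerm_insert hu.1 (fun h => htS (h ▸ ha))
      (fun h => hu.2 (h ▸ ha)) (fun h => htS (Finset.mem_of_mem_erase h)) huS]
    exact mul_mem (mul_mem (mul_mem hc hd) hc) hd

theorem exists_isThreeCycle_mem (hn : 4 ≤ n) {G : Subgroup (Equiv.Perm (Fin n → Fin 2))}
    (hG : ∀ g, IsLAryInstruction 3 g → g ∈ G) : ∃ g ∈ G, g.IsThreeCycle := by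
  classical
  have mem : ∀ t u : Fin n, t ≠ u → controlledFlipPerm t {t, u}ᶜ ∈ G := fun t u htu => by
    have hc : ({t, u}ᶜ : Finset (Fin n)).card = n - 2 := by
      rw [Finset.card_compl, Finset.card_pair htu, Fintype.card_fin]
    exact controlledFlipPerm_mem hG _ t _ (by simp) hc (by omega)
  have ha := mem ⟨0, by omega⟩ ⟨1, by omega⟩ (by simp)
  have hb := mem ⟨2, by omega⟩ ⟨3, by omega⟩ (by simp)
  refine ⟨_, mul_mem (mul_mem (mul_mem ha hb) ha) hb,
    isThreeCycle_of_involutive_of_unique_common_moved_point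
      (controlledFlip_involutive _ _) (controlledFlip_involutive _ _) (p := fun _ => 1) ?_ ?_ ?_⟩
  · intro x h1 h2
    rw [controlledFlipPerm_apply, controlledFlip_ne_self_iff] at h1 h2
    funext k
    by_cases hk : (k : ℕ) < 2
    · exact h2 k (by simp [Fin.ext_iff]; omega) (by simp [Fin.ext_iff]; omega)
    · exact h1 k (by simp [Fin.ext_iff]; omega) (by simp [Fin.ext_iff]; omega)
  · exact controlledFlip_ne_self_iff.2 fun _ _ _ => rfl
  · exact controlledFlip_ne_self_iff.2 fun _ _ _ => rfl

theorem addRight_mem {G : Subgroup (Equiv.Perm (Fin n → Fin 2))}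
    (hG : ∀ g, IsLAryInstruction 3 g → g ∈ G) (v : Fin n → Fin 2) :
    Equiv.addRight v ∈ G := by
  classical
  rw [← Finset.univ_sum_single v]
  refine Finset.sum_induction _ (fun w => Equiv.addRight w ∈ G) (fun a b ha hb => ?_) ?_
    fun i _ => hG _ ⟨i, fun x k hk => ?_, {i}, by simp, fun x y h => ?_⟩
  · rw [Equiv.addRight_add]
    exact mul_mem hb ha
  · rw [Equiv.addRight_zero]
    exact one_mem G
  · simp [hk]
  · simp [h i (by simp)]

theorem exists_mem_fix_zero_map_one {G : Subgroup (Equiv.Perm (Fin n → Fin 2))}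
    (hG : ∀ g, IsLAryInstruction 3 g → g ∈ G) (m : ℕ) :
    ∀ b : Fin n → Fin 2, b ≠ 0 → (Finset.univ.filter fun i => b i = 0).card = m →
      ∃ g ∈ G, g 0 = 0 ∧ g b = 1 := by
  have fin2 : ∀ c : Fin 2, c ≠ 0 → c = 1 := by decide
  induction m with
  | zero =>
    intro b _ hm
    refine ⟨1, one_mem G, rfl, funext fun i => fin2 _ fun hi => ?_⟩
    rw [Finset.card_eq_zero, Finset.filter_eq_empty_iff] at hm
    exact hm (Finset.mem_univ i) hi
  | succ m ih =>
    intro b hb hm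
    obtain ⟨j, hj⟩ : (Finset.univ.filter fun i => b i = 0).Nonempty :=
      Finset.card_pos.1 (by omega)
    obtain ⟨i, hi⟩ := Function.ne_iff.1 hb
    have hj0 : b j = 0 := (Finset.mem_filter.1 hj).2
    have hij : i ≠ j := fun h => hi (h ▸ hj0)
    have h0 : controlledFlipPerm j {i} 0 = 0 := by
      rw [controlledFlipPerm_apply]
      by_contra h
      simpa using controlledFlip_ne_self_iff.1 h i (by simp) hij
    have hbj : controlledFlip j {i} b j = 1 := by
      rw [controlledFlip, if_pos ⟨rfl, by simpa [hij] using fin2 _ hi⟩, hj0]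
      rfl
    obtain ⟨g, hg, hg0, hg1⟩ := ih (controlledFlip j {i} b)
      (fun h => by rw [h] at hbj; simp at hbj) (by
        have : (Finset.univ.filter fun k => controlledFlip j {i} b k = 0) =
            (Finset.univ.filter fun k => b k = 0).erase j := by
          ext k
          by_cases hk : k = j
          · subst hk
            simp [hbj]
          · simp [hk, controlledFlip_of_ne _ _ hk]
        rw [this, Finset.card_erase_of_mem hj, hm, Nat.add_sub_cancel])
    refine ⟨g * controlledFlipPerm j {i},
      mul_mem hg (hG _ (isLAryInstruction_controlledFlipPerm j (by simp))), ?_, ?_⟩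
    · rw [Equiv.Perm.mul_apply, h0, hg0]
    · rw [Equiv.Perm.mul_apply, controlledFlipPerm_apply, hg1]

theorem isPreprimitive_of_instruction_mem {G : Subgroup (Equiv.Perm (Fin n → Fin 2))}
    (hG : ∀ g, IsLAryInstruction 3 g → g ∈ G) :
    MulAction.IsPreprimitive G (Fin n → Fin 2) := by
  have key : ∀ a b : Fin n → Fin 2, a ≠ b → ∃ g ∈ G, g a = 0 ∧ g b = 1 := fun a b hab => by
    obtain ⟨g, hg, h0, h1⟩ := exists_mem_fix_zero_map_one hG _ (b + -a)
      (by rw [← sub_eq_add_neg, sub_ne_zero]; exact hab.symm) rfl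
    exact ⟨g * Equiv.addRight (-a), mul_mem hg (addRight_mem hG _), by simp [h0], by simpa using h1⟩
  refine MulAction.isPreprimitive_of_is_two_pretransitive
    (MulAction.is_two_pretransitive_iff.2 fun {a b c d} hab hcd => ?_)
  obtain ⟨g, hg, ga, gb⟩ := key a b hab
  obtain ⟨h, hh, hc, hd⟩ := key c d hcd
  refine ⟨⟨h⁻¹ * g, mul_mem (inv_mem hh) hg⟩, ?_, ?_⟩
  · rw [Subgroup.mk_smul, Equiv.Perm.smul_def, Equiv.Perm.mul_apply, ga, Equiv.Perm.inv_eq_iff_eq,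
      hc]
  · rw [Subgroup.mk_smul, Equiv.Perm.smul_def, Equiv.Perm.mul_apply, gb, Equiv.Perm.inv_eq_iff_eq,
      hd]

/-- A permutation of the states which preserves register `k` and commutes with the negation of
that register is even. -/
theorem sign_eq_one_of_commute_flip {g : Equiv.Perm (Fin n → Fin 2)} (k : Fin n)
    (hk : ∀ x, g x k = x k)
    (hc : ∀ x, g (controlledFlip k ∅ x) = controlledFlip k ∅ (g x)) :
    Equiv.Perm.sign g = 1 := by
  classical
  have flip : ∀ x : Fin n → Fin 2, controlledFlip k ∅ x k = x k + 1 := by simp [controlledFlip]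
  let h : Equiv.Perm (Fin n → Fin 2) :=
    Equiv.Perm.ofSubtype (g.subtypePerm (p := fun x => x k = 0) fun x => by rw [hk])
  have h0 : ∀ x, x k = 0 → h x = g x := fun x hx =>
    Equiv.Perm.ofSubtype_apply_of_mem (g.subtypePerm _) hx
  have h1 : ∀ x, x k ≠ 0 → h x = x := fun x hx =>
    Equiv.Perm.ofSubtype_apply_of_not_mem (g.subtypePerm _) hx
  have fin2 : ∀ c : Fin 2, c ≠ 0 ↔ c + 1 = 0 := by decide
  have key : g = h * (controlledFlipPerm k ∅ * h * controlledFlipPerm k ∅) := by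
    ext1 x
    simp only [Equiv.Perm.mul_apply, controlledFlipPerm_apply]
    by_cases hx : x k = 0
    · rw [h1 (controlledFlip k ∅ x) (by rw [flip, hx]; decide), controlledFlip_involutive, h0 x hx]
    · rw [h0 (controlledFlip k ∅ x) (by rw [flip]; exact (fin2 _).1 hx), hc,
        controlledFlip_involutive, h1 _ (by rwa [hk])]
  rw [key]
  simp only [map_mul]
  rcases Int.units_eq_one_or (Equiv.Perm.sign h) with e | e <;>
  rcases Int.units_eq_one_or (Equiv.Perm.sign (controlledFlipPerm k ∅)) with e' | e' <;>
  simp [e, e']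

theorem sign_eq_one_of_isLAryInstruction {l : ℕ} (hl : l < n)
    {g : Equiv.Perm (Fin n → Fin 2)} (hg : IsLAryInstruction l g) :
    Equiv.Perm.sign g = 1 := by
  obtain ⟨j, hj, S, hS, hgS⟩ := hg
  have hjS : j ∈ S := by
    by_contra h
    have e : g (controlledFlip j ∅ 0) = g 0 := by
      funext i
      by_cases hi : i = j
      · rw [hi]
        exact hgS _ _ fun k hk => controlledFlip_of_ne _ _ fun hkj => h (hkj ▸ hk)
      · rw [hj _ _ hi, hj _ _ hi, controlledFlip_of_ne _ _ hi]
    exact controlledFlip_ne_self_iff.2 (by simp) (g.injective e)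
  obtain ⟨k, hk⟩ : ∃ k, k ∉ S := by
    by_contra! h
    rw [Finset.eq_univ_iff_forall.2 h, Finset.card_univ, Fintype.card_fin] at hS
    omega
  have hkj : k ≠ j := fun h => hk (h ▸ hjS)
  refine sign_eq_one_of_commute_flip k (fun x => hj x k hkj) fun x => funext fun i => ?_
  by_cases hi : i = j
  · rw [hi, controlledFlip_of_ne _ _ hkj.symm]
    exact hgS _ _ fun m hm => controlledFlip_of_ne _ _ fun hmk => hk (hmk ▸ hm)
  · rw [hj _ _ hi]
    simp [controlledFlip, hj _ _ hi]

end Register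

/-- For `A = {0,1}`, `n ≥ 4` and `3 ≤ l ≤ n - 1`, the `l`-ary instructions
generate exactly the alternating group `Alt(A^n)`. -/
theorem lary_instructions_generate_alternating_binary
    (n l : ℕ) (hn : 4 ≤ n) (hl : 3 ≤ l) (hl' : l ≤ n - 1) :
    Subgroup.closure {g : Equiv.Perm (Fin n → Fin 2) | IsLAryInstruction l g} =
      alternatingGroup (Fin n → Fin 2) := by
  apply le_antisymm
  · rw [Subgroup.closure_le]
    exact fun g hg => Equiv.Perm.mem_alternatingGroup.2
      (Register.sign_eq_one_of_isLAryInstruction (by omega) hg)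
  · have hG : ∀ g : Equiv.Perm (Fin n → Fin 2), IsLAryInstruction 3 g →
        g ∈ Subgroup.closure {g : Equiv.Perm (Fin n → Fin 2) | IsLAryInstruction l g} :=
      fun g ⟨j, hj, S, hS, hgS⟩ => Subgroup.subset_closure ⟨j, hj, S, hS.trans hl, hgS⟩
    obtain ⟨g, hg, h3⟩ := Register.exists_isThreeCycle_mem hn hG
    exact Equiv.Perm.alternatingGroup_le_of_isPreprimitive_of_isThreeCycle_mem
      (Register.isPreprimitive_of_instruction_mem hG) h3 hg
end

section
/- Suppose q ≥ 3 is odd and n ≥ 3. For every l with 2 ≤ l ≤ n−1, the subgroup of Sym(A^n) generated by all l-ary instructions is the full symmetric group Sym(A^n). -/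
open Equiv Function
open scoped commutatorElement

section Gate

variable {ι A : Type*} [DecidableEq ι]

/-- The permutation of `ι → A` acting on coordinate `j` by a permutation of `A` that depends on
the remaining coordinates. -/
def gate (j : ι) : (({i // i ≠ j} → A) → Perm A) →* Perm (ι → A) where
  toFun f :=
    { toFun x := update x j (f (fun i => x i) (x j))
      invFun x := update x j ((f (fun i => x i))⁻¹ (x j))
      left_inv x := by
        have h (a : A) : (fun i : {i // i ≠ j} => update x j a i) = fun i : {i // i ≠ j} => x i :=
          funext fun i => update_of_ne i.2 _ _
        simp [h]
      right_inv x := by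
        have h (a : A) : (fun i : {i // i ≠ j} => update x j a i) = fun i : {i // i ≠ j} => x i :=
          funext fun i => update_of_ne i.2 _ _
        simp [h] }
  map_one' := by ext; simp
  map_mul' f g := by
    ext1 x
    have h (a : A) : (fun i : {i // i ≠ j} => update x j a i) = fun i : {i // i ≠ j} => x i :=
      funext fun i => update_of_ne i.2 _ _
    simp [h]

theorem gate_apply (j : ι) (f : ({i // i ≠ j} → A) → Perm A) (x : ι → A) :
    gate j f x = update x j (f (fun i => x i) (x j)) := rfl

variable [DecidableEq A]

theorem gate_mulSingle_swap [Fintype ι] (x : ι → A) (j : ι) (a b : A) :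
    gate j (Pi.mulSingle (fun i : {i // i ≠ j} => x i) (swap a b)) = swap (update x j a) (update x j b) := by
  ext1 y
  have key (d : A) : y = update x j d ↔
      (fun i : {i // i ≠ j} => y i) = (fun i : {i // i ≠ j} => x i) ∧ y j = d := by
    rw [eq_update_iff, and_comm, funext_iff]
    simp
  rw [gate_apply, swap_apply_def]
  simp only [key]
  by_cases h : (fun i : {i // i ≠ j} => y i) = fun i : {i // i ≠ j} => x i
  · have hu (d : A) : update y j d = update x j d := by
      ext i
      by_cases hi : i = j
      · subst hi; simp
      · simpa [hi] using congrFun h ⟨i, hi⟩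
    have hy : update x j (y j) = y := by rw [← hu, update_eq_self]
    rw [h, Pi.mulSingle_eq_same, swap_apply_def, hu]
    simp only [true_and]
    split_ifs <;> simp [hy]
  · rw [Pi.mulSingle_eq_of_ne h]
    simp [h]

theorem sign_gate [Fintype ι] [Fintype A] (j : ι) (f : ({i // i ≠ j} → A) → Perm A) :
    Perm.sign (gate j f) = ∏ y, Perm.sign (f y) := by
  rw [← Perm.sign_prodCongrRight]
  refine Perm.sign_eq_sign_of_equiv _ _ ((funSplitAt j A).trans (prodComm _ _)) fun x => ?_
  ext i
  · simp [gate_apply, update_of_ne i.2]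
  · simp [gate_apply]

end Gate

/-- A 3-cycle is its own commutator with a transposition on two of its points. -/
theorem commutatorElement_swap_threeCycle {A : Type*} [DecidableEq A] {a b c : A}
    (hab : a ≠ b) (hac : a ≠ c) (hbc : b ≠ c) :
    ⁅swap a b, swap a b * swap a c⁆ = swap a b * swap a c := by
  ext x
  simp only [commutatorElement_def, mul_inv_rev, swap_inv, Perm.mul_apply, swap_apply_def]
  grind

/-- A predicate stable under changing single coordinates holds everywhere once it holds
somewhere. -/
theorem forall_of_update {ι A : Type*} [Finite ι] [DecidableEq ι] {p : (ι → A) → Prop}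
    (hp : ∀ x j a, p x → p (update x j a)) {x : ι → A} (hx : p x) (y : ι → A) : p y := by
  have := Fintype.ofFinite ι
  suffices h : ∀ s : Finset ι, p (s.piecewise y x) by simpa using h Finset.univ
  intro s
  induction s using Finset.induction_on with
  | empty => simpa using hx
  | insert i s _ ih =>
    rw [Finset.piecewise_insert]
    exact hp _ _ _ ih

/-- A permutation group on `ι → A` containing all 3-cycles supported on axis-parallel lines
contains the alternating group. -/
theorem alternatingGroup_le_of_line_threeCycle_mem {ι A : Type*} [Fintype ι] [DecidableEq ι]
    [Nonempty ι] [Fintype A] [DecidableEq A] (hA : 3 ≤ Fintype.card A)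
    {H : Subgroup (Perm (ι → A))}
    (hH : ∀ (x : ι → A) (j : ι) (a b c : A), a ≠ b → a ≠ c → b ≠ c →
      swap (update x j a) (update x j b) * swap (update x j a) (update x j c) ∈ H) :
    alternatingGroup (ι → A) ≤ H := by
  have step (x : ι → A) (j : ι) (a : A) (ha : a ≠ x j) :
      ∃ z, z ≠ x ∧ z ≠ update x j a ∧ swap x z * swap x (update x j a) ∈ H := by
    obtain ⟨c, hc⟩ : ∃ c, c ∉ ({x j, a} : Finset A) :=
      Finset.exists_mem_notMem_of_card_lt_card (s := {x j, a}) (t := Finset.univ)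
        (Finset.card_le_two.trans_lt (by simp; omega)) |>.imp fun _ h => h.2
    simp only [Finset.mem_insert, Finset.mem_singleton, not_or] at hc
    refine ⟨update x j c, fun h => hc.1 ?_, fun h => hc.2 ?_, ?_⟩
    · simpa using congrFun h j
    · simpa using congrFun h j
    · simpa using hH x j (x j) c a (Ne.symm hc.1) ha.symm hc.2
  have : Nonempty A := Fintype.card_pos_iff.1 (by omega)
  have : MulAction.IsPretransitive H (ι → A) := by
    refine ⟨fun x => forall_of_update (x := x) (fun y j a hy => ?_) ⟨1, one_smul _ _⟩⟩
    obtain ⟨g, hg⟩ := hy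
    by_cases ha : a = y j
    · exact ⟨g, by simpa [ha] using hg⟩
    obtain ⟨z, hzy, hzu, hz⟩ := step y j a ha
    refine ⟨⟨_, hz⟩ * g, ?_⟩
    rw [mul_smul, hg, Subgroup.smul_def, Perm.smul_def, Perm.mul_apply, swap_apply_left,
      swap_apply_of_ne_of_ne (fun h => ha (by simpa using congrFun h j)) hzu.symm]
  have prim : MulAction.IsPreprimitive H (ι → A) := by
    refine ⟨fun {B} hB => ?_⟩
    rw [MulAction.IsTrivialBlock, or_iff_not_imp_left, Set.not_subsingleton_iff]
    intro hnt
    obtain ⟨x₀, hx₀⟩ := hnt.nonempty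
    refine Set.eq_univ_of_forall (forall_of_update (fun x j a hx => ?_) hx₀)
    by_contra hu
    have ha : a ≠ x j := fun h => hu (by rwa [h, update_eq_self])
    have hxu : update x j a ≠ x := fun h => hu (by rwa [h])
    obtain ⟨z, hzx, hzu, hz⟩ := step x j a ha
    obtain ⟨y, hy, hyx⟩ := hnt.exists_ne x
    have hdisj : ∀ w ∈ B, (swap x z * swap x (update x j a)) w ∉ B := by
      rcases hB.smul_eq_or_disjoint ⟨_, hz⟩ with h | h
      · refine absurd (h ▸ Set.smul_mem_smul_set hx) ?_
        rwa [Subgroup.smul_def, Perm.smul_def, Perm.mul_apply, swap_apply_left,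
          swap_apply_of_ne_of_ne hxu hzu.symm]
      · exact fun w hw hw' => Set.disjoint_left.1 h (Set.smul_mem_smul_set hw) hw'
    have hyu : y ≠ update x j a := fun h => hu (h ▸ hy)
    refine hdisj y hy ?_
    rw [Perm.mul_apply, swap_apply_of_ne_of_ne hyx hyu]
    by_cases hyz : y = z
    · rwa [hyz, swap_apply_right]
    · rwa [swap_apply_of_ne_of_ne hyx hyz]
  obtain ⟨j⟩ := ‹Nonempty ι›
  obtain ⟨x⟩ := (inferInstance : Nonempty (ι → A))
  obtain ⟨a, ha⟩ : ∃ a, a ≠ x j := by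
    have : Nontrivial A := Fintype.one_lt_card_iff_nontrivial.1 (by omega)
    exact exists_ne _
  obtain ⟨z, hzx, hzu, hz⟩ := step x j a ha
  exact Perm.alternatingGroup_le_of_isPreprimitive_of_isThreeCycle_mem prim
    (Perm.isThreeCycle_swap_mul_swap_same hzx.symm
      (fun h => ha (by simpa using (congrFun h j).symm)) hzu) hz

/-- If a subgroup of `(ι → A) → Perm A` contains the functions depending on at most one
coordinate, it contains every function supported at one point whose value there is a 3-cycle. -/
theorem mulSingle_threeCycle_mem {ι A : Type*} [Fintype ι] [DecidableEq A]
    {K : Subgroup ((ι → A) → Perm A)} (hconst : ∀ σ : Perm A, (fun _ => σ) ∈ K)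
    (hunary : ∀ (i : ι) (f : A → Perm A), (fun y => f (y i)) ∈ K) (y : ι → A) {a b c : A}
    (hab : a ≠ b) (hac : a ≠ c) (hbc : b ≠ c) :
    Pi.mulSingle y (swap a b * swap a c) ∈ K := by
  classical
  have key (s : Finset ι) :
      (fun z : ι → A => if ∀ i ∈ s, z i = y i then swap a b * swap a c else 1) ∈ K := by
    induction s using Finset.induction_on with
    | empty => simpa using hconst _
    | insert i s _ ih =>
      have hi := hunary i fun d => if d = y i then swap a b else 1
      convert K.mul_mem (K.mul_mem (K.mul_mem hi ih) (K.inv_mem hi)) (K.inv_mem ih) using 1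
      ext1 z
      have hcomm := commutatorElement_swap_threeCycle hab hac hbc
      rw [commutatorElement_def] at hcomm
      simp only [Finset.forall_mem_insert, Pi.mul_apply, Pi.inv_apply]
      by_cases h₁ : z i = y i <;> by_cases h₂ : ∀ i ∈ s, z i = y i
      · simp only [h₁, if_pos h₂, if_true, true_and, hcomm]
      all_goals simp [h₁, h₂]
  convert key Finset.univ using 1
  ext1 z
  simp [Pi.mulSingle_apply, funext_iff]

theorem isLAryInstruction_gate {n l : ℕ} {A : Type*} (j : Fin n)
    (s : Finset {i // i ≠ j}) (hs : s.card + 1 ≤ l) (f : ({i // i ≠ j} → A) → Perm A)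
    (hf : ∀ y z, (∀ i ∈ s, y i = z i) → f y = f z) : IsLAryInstruction l (gate j f) := by
  refine ⟨j, fun x i hi => by simp [gate_apply, hi],
    insert j (s.map (Embedding.subtype _)), ?_, fun x y h => ?_⟩
  · exact (Finset.card_insert_le _ _).trans (by simpa using hs)
  · simp only [gate_apply, update_self]
    rw [hf (fun i => x i) (fun i => y i) fun i hi => h i (by simp [hi, i.2]), h j (by simp)]

/-- For odd `q ≥ 3`, `n ≥ 3` and `2 ≤ l ≤ n - 1`, the `l`-ary instructions
generate the full symmetric group `Sym(A^n)`. -/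
theorem lary_instructions_generate_symmetric_odd
    (q n l : ℕ) (A : Type*) [Fintype A] [DecidableEq A]
    (hA : Fintype.card A = q) (hq : 3 ≤ q) (hodd : Odd q) (hn : 3 ≤ n)
    (hl : 2 ≤ l) (hl' : l ≤ n - 1) :
    Subgroup.closure {g : Equiv.Perm (Fin n → A) | IsLAryInstruction l g} =
      ⊤ := by
  have : NeZero n := ⟨by omega⟩
  set H := Subgroup.closure {g : Perm (Fin n → A) | IsLAryInstruction l g}
  have hconst (j : Fin n) (σ : Perm A) : gate j (fun _ => σ) ∈ H :=
    Subgroup.subset_closure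
      (isLAryInstruction_gate j ∅ (by simpa using one_le_two.trans hl) _ fun _ _ _ => rfl)
  have halt : alternatingGroup (Fin n → A) ≤ H := by
    refine alternatingGroup_le_of_line_threeCycle_mem (hA ▸ hq) fun x j a b c hab hac hbc => ?_
    rw [← gate_mulSingle_swap, ← gate_mulSingle_swap, ← map_mul, ← Pi.mulSingle_mul]
    refine mulSingle_threeCycle_mem (K := H.comap (gate j)) (hconst j) (fun i f => ?_) _ hab hac hbc
    exact Subgroup.subset_closure
      (isLAryInstruction_gate j {i} (by simpa using hl) _ fun y z h => by simp [h i (by simp)])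
  obtain ⟨a, b, hab⟩ : ∃ a b : A, a ≠ b := Fintype.exists_pair_of_one_lt_card (by omega)
  have hsign : Perm.sign (gate (0 : Fin n) (fun _ => swap a b)) = -1 := by
    rw [sign_gate]
    simp only [Perm.sign_swap hab, Finset.prod_const, Finset.card_univ, Fintype.card_fun, hA]
    exact hodd.pow.neg_one_pow
  refine eq_top_iff.2 fun g _ => ?_
  rcases Int.units_eq_one_or (Perm.sign g) with hg | hg
  · exact halt (Perm.mem_alternatingGroup.2 hg)
  · refine (H.mul_mem_cancel_right (hconst 0 (swap a b))).1 (halt (Perm.mem_alternatingGroup.2 ?_))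
    rw [map_mul, hg, hsign]
    rfl
end

section
/- If q is even, then every (n−1)-ary instruction on A^n is an even permutation of A^n. -/
/-- A permutation of `α × β` fixing the first coordinate and acting on the second coordinate
independently of the first is even when `α` has even cardinality. -/
theorem sign_eq_one_of_fst_of_snd {α β : Type*} [Fintype α] [DecidableEq α] [Nonempty α]
    [Fintype β] [DecidableEq β] (hα : Even (Fintype.card α)) (f : Equiv.Perm (α × β))
    (h₁ : ∀ p, (f p).1 = p.1) (h₂ : ∀ a b y, (f (a, y)).2 = (f (b, y)).2) :
    Equiv.Perm.sign f = 1 := by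
  obtain ⟨a₀⟩ := ‹Nonempty α›
  have hinj : Function.Injective fun y => (f (a₀, y)).2 := fun y z hyz => by
    have h : f (a₀, y) = f (a₀, z) := Prod.ext (by rw [h₁, h₁]) hyz
    exact congrArg Prod.snd (f.injective h)
  have hf : f = Equiv.prodCongrRight fun _ : α =>
      Equiv.ofBijective _ (Finite.injective_iff_bijective.mp hinj) := by
    ext ⟨a, y⟩ : 1
    exact Prod.ext (h₁ _) (h₂ _ _ _)
  rw [hf, Equiv.Perm.sign_prodCongrRight, Finset.prod_const, Finset.card_univ]
  obtain ⟨m, hm⟩ := hα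
  rw [hm, pow_add, Int.units_mul_self]

/-- If `q` is even, every `(n-1)`-ary instruction is an even permutation. -/
theorem lary_instruction_even_perm
    (q n : ℕ) (A : Type*) [Fintype A] [DecidableEq A]
    (hA : Fintype.card A = q) (hq : 2 ≤ q) (hn : 2 ≤ n) (heven : Even q) :
    ∀ g : Equiv.Perm (Fin n → A), IsLAryInstruction (n - 1) g →
      g ∈ alternatingGroup (Fin n → A) := by
  rintro g ⟨j, hj, S, hS, hg⟩
  have : Nontrivial A := Fintype.one_lt_card_iff_nontrivial.mp (by omega)
  obtain ⟨k, hk⟩ : ∃ k, k ∉ S := by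
    by_contra! h
    have := Finset.card_eq_of_equiv_fin (s := S) (n := n)
      (Equiv.subtypeUnivEquiv h)
    omega
  have hkj : k ≠ j := by
    rintro rfl
    obtain ⟨a, b, hab⟩ := exists_pair_ne A
    have h : g (fun _ => a) = g (Function.update (fun _ => a) k b) := by
      ext i
      by_cases hi : i = k
      · subst hi
        refine hg _ _ fun l hl => ?_
        rw [Function.update_of_ne (ne_of_mem_of_not_mem hl hk)]
      · rw [hj _ _ hi, hj _ _ hi, Function.update_of_ne hi]
    exact hab (by simpa using congrFun (g.injective h) k)
  rw [Equiv.Perm.mem_alternatingGroup, ← Equiv.Perm.sign_permCongr (Equiv.funSplitAt k A) g]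
  refine sign_eq_one_of_fst_of_snd (hA ▸ heven) _ ?_ ?_
  · rintro ⟨a, y⟩
    simp [Equiv.permCongr_apply, Equiv.funSplitAt, Equiv.piSplitAt, hj _ _ hkj]
  · intro a b y
    ext ⟨i, hi⟩
    simp only [Equiv.permCongr_apply, Equiv.funSplitAt_apply]
    by_cases hij : i = j
    · subst hij
      refine hg _ _ fun l hl => ?_
      simp [Equiv.funSplitAt_symm_apply, ne_of_mem_of_not_mem hl hk]
    · rw [hj _ _ hij, hj _ _ hij]
      simp [Equiv.funSplitAt_symm_apply, hi]
end

section
/- Let h be a permutation of A^n. Then h⁻¹ g h is an instruction for every instruction g if and only if h is a unary permutation. In other words, the largest group acting by conjugation on the set of all instructions is the group U = Sym(A) Wr Sym(n) of unary permutations. -/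
/-- An *instruction* on `A^n` is a permutation of `Fin n → A` which changes
at most one coordinate (the updated register `j`). -/
def IsInstruction {n : ℕ} {A : Type*} (g : Equiv.Perm (Fin n → A)) : Prop :=
  ∃ j : Fin n, ∀ (x : Fin n → A) (i : Fin n), i ≠ j → g x i = x i

/-- A *unary permutation* of `A^n` is an element of the wreath product
`Sym(A) Wr Sym(n)`: it permutes the registers and then acts on each
coordinate separately. -/
def IsUnaryPerm {n : ℕ} {A : Type*} (f : Equiv.Perm (Fin n → A)) : Prop :=
  ∃ (π : Equiv.Perm (Fin n)) (h : Fin n → Equiv.Perm A),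
    ∀ (x : Fin n → A) (i : Fin n), f x i = h i (x (π i))

/-- A function that is unchanged by updates of the coordinates other than those in `p`
depends only on the coordinates in `p`. -/
theorem eq_of_update_invariant {ι A B : Type*} [Fintype ι] [DecidableEq ι]
    (F : (ι → A) → B) (p : ι → Prop)
    (hF : ∀ j, ¬ p j → ∀ x a, F (Function.update x j a) = F x)
    {x y : ι → A} (hxy : ∀ j, p j → x j = y j) : F x = F y := by
  have key : ∀ s : Finset ι, F (s.piecewise x y) = F y := by
    intro s
    induction s using Finset.induction_on with
    | empty => simp
    | insert j s hj ih =>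
      rw [Finset.piecewise_insert]
      by_cases hp : p j
      · rw [hxy j hp, ← Finset.piecewise_eq_of_notMem s x y hj, Function.update_eq_self, ih]
      · rw [hF j hp, ih]
  simpa using key Finset.univ

/-- The instruction applying the permutation `σ` to the register `j`. -/
def updatePerm {n : ℕ} {A : Type*} (j : Fin n) (σ : Equiv.Perm A) : Equiv.Perm (Fin n → A) :=
  Equiv.piCongrRight (Function.update 1 j σ)

theorem updatePerm_apply {n : ℕ} {A : Type*} (j : Fin n) (σ : Equiv.Perm A) (x : Fin n → A) :
    updatePerm j σ x = Function.update x j (σ (x j)) := by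
  ext i
  by_cases hi : i = j
  · subst hi; simp [updatePerm]
  · simp [updatePerm, hi]

theorem updatePerm_zpow {n : ℕ} {A : Type*} (j : Fin n) (σ : Equiv.Perm A) (m : ℤ) :
    updatePerm j σ ^ m = updatePerm j (σ ^ m) := by
  have hmul : ∀ σ τ : Equiv.Perm A,
      updatePerm j (σ * τ) = updatePerm j σ * updatePerm j τ := by
    intro σ τ
    ext1 x
    simp [updatePerm_apply]
  exact (map_zpow (MonoidHom.mk' (updatePerm j) hmul) σ m).symm

theorem isInstruction_updatePerm {n : ℕ} {A : Type*} (j : Fin n) (σ : Equiv.Perm A) :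
    IsInstruction (updatePerm j σ) :=
  ⟨j, fun x i hi => by rw [updatePerm_apply, Function.update_of_ne hi]⟩

/-- A function invariant under a permutation is invariant under its integer powers. -/
theorem apply_zpow_of_invariant {X B : Type*} {g : Equiv.Perm X} {F : X → B}
    (hg : ∀ x, F (g x) = F x) (m : ℤ) (x : X) : F ((g ^ m) x) = F x := by
  induction m generalizing x with
  | zero => simp
  | succ m ih => rw [zpow_add_one, Equiv.Perm.mul_apply, ih, hg]
  | pred m ih =>
    rw [zpow_sub_one, Equiv.Perm.mul_apply, ih, ← hg (g⁻¹ x), ← Equiv.Perm.mul_apply,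
      mul_inv_cancel, Equiv.Perm.one_apply]

theorem inv_apply_of_unary {n : ℕ} {A : Type*} {f : Equiv.Perm (Fin n → A)}
    {π : Equiv.Perm (Fin n)} {h : Fin n → Equiv.Perm A}
    (hf : ∀ x i, f x i = h i (x (π i))) (x : Fin n → A) (i : Fin n) :
    f⁻¹ x i = (h (π.symm i)).symm (x (π.symm i)) := by
  rw [Equiv.eq_symm_apply]
  simpa using (hf (f⁻¹ x) (π.symm i)).symm

theorem IsUnaryPerm.inv {n : ℕ} {A : Type*} {f : Equiv.Perm (Fin n → A)}
    (hf : IsUnaryPerm f) : IsUnaryPerm f⁻¹ := by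
  obtain ⟨π, h, hf⟩ := hf
  exact ⟨π.symm, fun i => (h (π.symm i)).symm, inv_apply_of_unary hf⟩

theorem IsUnaryPerm.conj_isInstruction {n : ℕ} {A : Type*} {h g : Equiv.Perm (Fin n → A)}
    (hh : IsUnaryPerm h) (hg : IsInstruction g) : IsInstruction (h⁻¹ * g * h) := by
  obtain ⟨π, f, hf⟩ := hh
  obtain ⟨j, hj⟩ := hg
  refine ⟨π j, fun x i hi => ?_⟩
  have hne : π.symm i ≠ j := fun e => hi (by rw [← e, Equiv.apply_symm_apply])
  rw [Equiv.Perm.mul_apply, Equiv.Perm.mul_apply, inv_apply_of_unary hf, hj _ _ hne, hf]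
  simp

/-- A permutation mapping every line of `A^n` into a line whose direction depends only on the
direction of the original line is unary. -/
theorem isUnaryPerm_of_update {n : ℕ} {A : Type*} [Finite A] [Nontrivial A]
    (k : Equiv.Perm (Fin n → A)) (ρ : Fin n → Fin n)
    (hk : ∀ j x a i, i ≠ ρ j → k (Function.update x j a) i = k x i) : IsUnaryPerm k := by
  obtain ⟨a₀, a₁, hne⟩ := exists_pair_ne A
  have hsurj : Function.Surjective ρ := by
    intro i
    by_contra! hi
    have hconst : ∀ x y, k x i = k y i := fun x y =>
      eq_of_update_invariant (fun x => k x i) (fun _ => False)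
        (fun j _ x a => hk j x a i (hi j).symm) (by simp)
    have := hconst (k.symm fun _ => a₀) (k.symm fun _ => a₁)
    simp only [Equiv.apply_symm_apply] at this
    exact hne this
  let π : Equiv.Perm (Fin n) :=
    (Equiv.ofBijective ρ (Finite.surjective_iff_bijective.mp hsurj)).symm
  have hπ : ∀ i, ρ (π i) = i :=
    (Equiv.ofBijective ρ (Finite.surjective_iff_bijective.mp hsurj)).apply_symm_apply
  have hdep : ∀ i x, k x i = k (fun _ => x (π i)) i := fun i x =>
    eq_of_update_invariant (fun x => k x i) (fun j => j = π i)
      (fun j hj x a => hk j x a i fun e =>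
        hj ((Finite.injective_iff_surjective.mpr hsurj) (by rw [hπ, e])))
      (by rintro j rfl; rfl)
  have hbij : ∀ i, Function.Bijective fun a => k (fun _ => a) i := fun i =>
    Finite.surjective_iff_bijective.mp fun b =>
      ⟨k.symm (fun _ => b) (π i), by simp only [← hdep, Equiv.apply_symm_apply]⟩
  exact ⟨π, fun i => Equiv.ofBijective _ (hbij i), fun x i => hdep i x⟩

theorem isUnaryPerm_of_conj_isInstruction {n : ℕ} {A : Type*} [Fintype A] [DecidableEq A]
    [Nontrivial A] {h : Equiv.Perm (Fin n → A)}
    (hh : ∀ g : Equiv.Perm (Fin n → A), IsInstruction g → IsInstruction (h⁻¹ * g * h)) :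
    IsUnaryPerm h := by
  obtain ⟨σ, hσ, -⟩ := Finset.exists_cycleOn (Finset.univ : Finset A)
  choose ρ hρ using fun j => hh _ (isInstruction_updatePerm j σ)
  suffices IsUnaryPerm h⁻¹ by simpa using this.inv
  refine isUnaryPerm_of_update _ ρ fun j x a i hi => ?_
  obtain ⟨m, hm⟩ := hσ.2 (x := x j) (y := a) (by simp) (by simp)
  have hg : ∀ y, h⁻¹ (updatePerm j σ y) i = h⁻¹ y i := fun y => by
    simpa using hρ j (h⁻¹ y) i hi
  have := apply_zpow_of_invariant (F := fun y => h⁻¹ y i) hg m x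
  rwa [updatePerm_zpow, updatePerm_apply, hm] at this

/-- A permutation `h` of `A^n` normalises the set of instructions (i.e.
`h⁻¹ g h` is an instruction for every instruction `g`) if and only if `h`
is unary: the largest group acting by conjugation on the instructions is
`U = Sym(A) Wr Sym(n)`. -/
theorem conjugation_preserves_instructions_iff_unary
    (q n : ℕ) (A : Type*) [Fintype A] [DecidableEq A]
    (hA : Fintype.card A = q) (hq : 2 ≤ q) (hn : 2 ≤ n)
    (h : Equiv.Perm (Fin n → A)) :
    (∀ g : Equiv.Perm (Fin n → A), IsInstruction g →
        IsInstruction (h⁻¹ * g * h)) ↔ IsUnaryPerm h := by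
  have : Nontrivial A := Fintype.one_lt_card_iff_nontrivial.mp (by omega)
  exact ⟨isUnaryPerm_of_conj_isInstruction, fun hh _ hg => hh.conj_isInstruction hg⟩
end

section
/- If q ≥ 3 and n ≥ 2, or q = 2 and n ≥ 4, then the subgroup of Sym(A^n) generated by the set of all instructions that are even permutations of A^n is exactly the alternating group Alt(A^n). (That is, Alt(A^n) is internally computable.) -/
open Equiv Equiv.Perm

namespace InternallyComputable

/-- A permutation group containing, for each edge `x`, `y` of a connected graph, a 3-cycle
`x ↦ y ↦ z ↦ x` contains the alternating group. -/
theorem alternatingGroup_le_of_connected {α : Type*} [Fintype α] [DecidableEq α] [Nontrivial α]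
    {G : Subgroup (Perm α)} {R : α → α → Prop} (hR : ∀ x y, Relation.ReflTransGen R x y)
    (hG : ∀ x y, R x y → ∃ z, x ≠ y ∧ x ≠ z ∧ z ≠ y ∧ swap x z * swap x y ∈ G) :
    alternatingGroup α ≤ G := by
  have htrans : MulAction.IsPretransitive G α := by
    refine ⟨fun x y => ?_⟩
    induction hR x y with
    | refl => exact ⟨1, one_smul _ _⟩
    | tail _ hbc ih =>
      obtain ⟨g, hg⟩ := ih
      obtain ⟨z, hxy, -, hzy, hc⟩ := hG _ _ hbc
      refine ⟨⟨_, hc⟩ * g, ?_⟩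
      rw [mul_smul, hg]
      simp [Subgroup.smul_def, swap_apply_of_ne_of_ne hxy.symm hzy.symm]
  have hprim : MulAction.IsPreprimitive G α := by
    refine ⟨fun {B} hB => or_iff_not_imp_left.2 fun hsub => ?_⟩
    rw [Set.not_subsingleton_iff] at hsub
    obtain ⟨u, hu⟩ := hsub.nonempty
    refine Set.eq_univ_of_forall fun v => ?_
    induction hR u v with
    | refl => exact hu
    | @tail x y _ hxy hx =>
      obtain ⟨z, hne, hxz, hzy, hc⟩ := hG _ _ hxy
      obtain ⟨w, hw, hwx⟩ := hsub.exists_ne x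
      by_contra hy
      have hwy : w ≠ y := fun h => hy (h ▸ hw)
      have hgw : (⟨_, hc⟩ : G) • w ∈ B := by
        by_cases hwz : w = z
        · simpa [Subgroup.smul_def, hwz, swap_apply_of_ne_of_ne hxz.symm hzy] using hx
        · simpa [Subgroup.smul_def, swap_apply_of_ne_of_ne hwx hwy,
            swap_apply_of_ne_of_ne hwx hwz] using hw
      apply hy
      rw [← hB.smul_eq_of_mem hw hgw]
      refine ⟨x, hx, ?_⟩
      simp [Subgroup.smul_def, swap_apply_of_ne_of_ne hne.symm hzy.symm]
  obtain ⟨x, y, hxy⟩ := exists_pair_ne α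
  obtain h | ⟨y, hy, -⟩ := (hR x y).cases_head
  · exact absurd h hxy
  obtain ⟨z, hne, hxz, hzy, hc⟩ := hG _ _ hy
  exact alternatingGroup_le_of_isPreprimitive_of_isThreeCycle_mem hprim
    (isThreeCycle_swap_mul_swap_same hxz hne hzy) hc

/-- If `x` is the only point moved by both involutions `g` and `h`, then their commutator is the
3-cycle `x ↦ g x ↦ h x ↦ x`. -/
theorem commutator_eq_swap_mul_swap {α : Type*} [DecidableEq α] {g h : Perm α} {x : α}
    (hg : ∀ w, g (g w) = w) (hh : ∀ w, h (h w) = w) (hgx : g x ≠ x) (hhx : h x ≠ x)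
    (hx : ∀ w, w ≠ x → g w = w ∨ h w = w) :
    g * h * g * h = swap x (h x) * swap x (g x) := by
  have h1 : h (g x) = g x := (hx _ hgx).resolve_left fun h => hgx (by rw [hg] at h; exact h.symm)
  have h2 : g (h x) = h x := (hx _ hhx).resolve_right fun h => hhx (by rw [hh] at h; exact h.symm)
  have hne : h x ≠ g x := fun h' => hgx (h1.symm.trans (by rw [← h', hh]))
  ext w
  simp only [Perm.mul_apply]
  by_cases hwx : w = x
  · subst hwx
    simp [h2, hh, swap_apply_of_ne_of_ne hgx hne.symm]
  by_cases hwg : w = g x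
  · subst hwg
    simp [h1, h2, hg]
  by_cases hwh : w = h x
  · subst hwh
    simp [h1, hh, hg, swap_apply_of_ne_of_ne hhx hne]
  rw [swap_apply_of_ne_of_ne hwx hwg, swap_apply_of_ne_of_ne hwx hwh]
  have h3 : g w ≠ x := fun h => hwg (by rw [← h, hg])
  have h4 : h w ≠ x := fun h' => hwh (by rw [← h', hh])
  have h5 := hx w hwx
  have h6 := hx _ h3
  have h7 := hx _ h4
  rw [hg] at h6
  rw [hh] at h7
  grind

variable {n : ℕ} {A : Type*} [DecidableEq A]

theorem swap_update_apply_of_ne (x : Fin n → A) (i : Fin n) (a : A) :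
    ∀ (w : Fin n → A) (j : Fin n), j ≠ i → swap x (Function.update x i a) w j = w j := by
  intro w j hj
  rw [swap_apply_def]
  split_ifs <;> simp [*]

theorem reflTransGen_update (x y : Fin n → A) :
    Relation.ReflTransGen (fun x y => ∃ i a, a ≠ x i ∧ y = Function.update x i a) x y := by
  have key (s : Finset (Fin n)) : Relation.ReflTransGen
      (fun x y => ∃ i a, a ≠ x i ∧ y = Function.update x i a) x (s.piecewise y x) := by
    induction s using Finset.induction_on with
    | empty => simpa using Relation.ReflTransGen.refl
    | insert j s _ ih =>
      rw [Finset.piecewise_insert]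
      by_cases hj : y j = s.piecewise y x j
      · rwa [hj, Function.update_eq_self]
      · exact ih.tail ⟨j, y j, hj, rfl⟩
  simpa using key Finset.univ

/-- The instruction exchanging `x` with `x[i := a]` and `x[k := c]` with
`x[k := c, i := a]`. -/
def doubleSwap (x : Fin n → A) (i k : Fin n) (a c : A) : Perm (Fin n → A) :=
  swap x (Function.update x i a) *
    swap (Function.update x k c) (Function.update (Function.update x k c) i a)

variable {x : Fin n → A} {i k : Fin n} {a c : A}

theorem doubleSwap_apply (hik : i ≠ k) (hc : c ≠ x k) (w : Fin n → A) :
    doubleSwap x i k a c w = if w = x then Function.update x i a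
      else if w = Function.update x i a then x
      else if w = Function.update x k c then Function.update (Function.update x k c) i a
      else if w = Function.update (Function.update x k c) i a then Function.update x k c
      else w := by
  have e1 : Function.update x k c ≠ x := fun h => hc (by simpa using congrFun h k)
  have e2 : Function.update (Function.update x k c) i a ≠ x :=
    fun h => hc (by simpa [hik.symm] using congrFun h k)
  have e3 : Function.update x k c ≠ Function.update x i a :=
    fun h => hc (by simpa [hik.symm] using congrFun h k)
  have e4 : Function.update (Function.update x k c) i a ≠ Function.update x i a :=
    fun h => hc (by simpa [hik.symm] using congrFun h k)
  simp only [doubleSwap, Perm.mul_apply, swap_apply_def]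
  grind

theorem doubleSwap_self (hik : i ≠ k) (hc : c ≠ x k) :
    doubleSwap x i k a c x = Function.update x i a := by
  simp [doubleSwap_apply hik hc]

theorem doubleSwap_doubleSwap (hik : i ≠ k) (hc : c ≠ x k) (w : Fin n → A) :
    doubleSwap x i k a c (doubleSwap x i k a c w) = w := by
  have e1 : Function.update x k c ≠ x := fun h => hc (by simpa using congrFun h k)
  have e2 : Function.update (Function.update x k c) i a ≠ x :=
    fun h => hc (by simpa [hik.symm] using congrFun h k)
  have e3 : Function.update x k c ≠ Function.update x i a :=
    fun h => hc (by simpa [hik.symm] using congrFun h k)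
  have e4 : Function.update (Function.update x k c) i a ≠ Function.update x i a :=
    fun h => hc (by simpa [hik.symm] using congrFun h k)
  simp only [doubleSwap_apply hik hc]
  grind

theorem eq_of_doubleSwap_ne (hik : i ≠ k) (hc : c ≠ x k) {w : Fin n → A}
    (hw : doubleSwap x i k a c w ≠ w) {j : Fin n} (hji : j ≠ i) (hjk : j ≠ k) : w j = x j := by
  rw [doubleSwap_apply hik hc] at hw
  split_ifs at hw <;> simp_all

theorem isInstruction_doubleSwap (x : Fin n → A) (i k : Fin n) (a c : A) :
    IsInstruction (doubleSwap x i k a c) := by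
  refine ⟨i, fun w j hj => ?_⟩
  rw [doubleSwap, Perm.mul_apply, swap_update_apply_of_ne _ _ _ _ _ hj,
    swap_update_apply_of_ne _ _ _ _ _ hj]

theorem doubleSwap_mem_alternatingGroup [Fintype A] (hik : i ≠ k) (ha : a ≠ x i) :
    doubleSwap x i k a c ∈ alternatingGroup (Fin n → A) := by
  have e1 : x ≠ Function.update x i a := fun h => ha (by simpa using (congrFun h i).symm)
  have e2 : Function.update x k c ≠ Function.update (Function.update x k c) i a :=
    fun h => ha (by simpa [hik] using (congrFun h i).symm)
  simp [mem_alternatingGroup, doubleSwap, sign_swap e1, sign_swap e2]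

end InternallyComputable

open InternallyComputable in
/-- If `q ≥ 3` and `n ≥ 2`, or `q = 2` and `n ≥ 4`, the even instructions
generate exactly the alternating group `Alt(A^n)`: the alternating group is
internally computable. -/
theorem alternating_internally_computable
    (q n : ℕ) (A : Type*) [Fintype A] [DecidableEq A]
    (hA : Fintype.card A = q)
    (h : (3 ≤ q ∧ 2 ≤ n) ∨ (q = 2 ∧ 4 ≤ n)) :
    Subgroup.closure
        {g : Equiv.Perm (Fin n → A) |
          IsInstruction g ∧ g ∈ alternatingGroup (Fin n → A)} =
      alternatingGroup (Fin n → A) := by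
  refine le_antisymm ((Subgroup.closure_le _).2 fun g hg => hg.2) ?_
  have hA' : 2 ≤ Fintype.card A := by omega
  have : Nontrivial A := Fintype.one_lt_card_iff_nontrivial.1 hA'
  have : Nonempty (Fin n) := ⟨⟨0, by omega⟩⟩
  refine alternatingGroup_le_of_connected reflTransGen_update ?_
  rintro x _ ⟨i, a, ha, rfl⟩
  have hx : x ≠ Function.update x i a := fun h => ha (by simpa using (congrFun h i).symm)
  rcases h with ⟨hq, -⟩ | ⟨-, hn⟩
  · obtain ⟨b, hb⟩ := Finset.exists_mem_notMem_of_card_lt_card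
      (s := {a, x i}) (t := (Finset.univ : Finset A))
      (lt_of_le_of_lt Finset.card_le_two (by rw [Finset.card_univ]; omega))
    simp only [Finset.mem_univ, Finset.mem_insert, Finset.mem_singleton, not_or, true_and] at hb
    have hxb : x ≠ Function.update x i b := fun h => hb.2 (by simpa using (congrFun h i).symm)
    have hba : Function.update x i b ≠ Function.update x i a :=
      fun h => hb.1 (by simpa using congrFun h i)
    refine ⟨Function.update x i b, hx, hxb, hba, Subgroup.subset_closure
      ⟨⟨i, fun w j hj => ?_⟩, (isThreeCycle_swap_mul_swap_same hxb hx hba).mem_alternatingGroup⟩⟩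
    rw [Perm.mul_apply, swap_update_apply_of_ne _ _ _ _ _ hj,
      swap_update_apply_of_ne _ _ _ _ _ hj]
  · obtain ⟨j, hj⟩ := Finset.exists_mem_notMem_of_card_lt_card
      (s := {i}) (t := (Finset.univ : Finset (Fin n))) (by simp; omega)
    obtain ⟨k, hk⟩ := Finset.exists_mem_notMem_of_card_lt_card
      (s := {i, j}) (t := (Finset.univ : Finset (Fin n)))
      (lt_of_le_of_lt Finset.card_le_two (by simp; omega))
    obtain ⟨l, hl⟩ := Finset.exists_mem_notMem_of_card_lt_card
      (s := {i, j, k}) (t := (Finset.univ : Finset (Fin n)))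
      (lt_of_le_of_lt Finset.card_le_three (by simp; omega))
    simp only [Finset.mem_univ, Finset.mem_insert, Finset.mem_singleton, not_or, true_and]
      at hj hk hl
    obtain ⟨b, hb⟩ := exists_ne (x j)
    obtain ⟨c, hc⟩ := exists_ne (x k)
    obtain ⟨d, hd⟩ := exists_ne (x l)
    have hik : i ≠ k := Ne.symm hk.1
    have hjl : j ≠ l := Ne.symm hl.2.1
    have hxb : x ≠ Function.update x j b := fun h => hb (by simpa using (congrFun h j).symm)
    have hba : Function.update x j b ≠ Function.update x i a :=
      fun h => hb (by simpa [hj] using congrFun h j)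
    have hcomm := commutator_eq_swap_mul_swap (x := x)
      (doubleSwap_doubleSwap hik hc) (doubleSwap_doubleSwap hjl hd)
      (by rw [doubleSwap_self hik hc]; exact hx.symm)
      (by rw [doubleSwap_self hjl hd]; exact hxb.symm)
      (by
        intro w hw
        by_contra! hcon
        refine hw (funext fun m => ?_)
        by_cases hm : m = i ∨ m = k
        · exact eq_of_doubleSwap_ne hjl hd hcon.2 (by grind) (by grind)
        · rw [not_or] at hm
          exact eq_of_doubleSwap_ne hik hc hcon.1 hm.1 hm.2)
    rw [doubleSwap_self hik hc, doubleSwap_self hjl hd] at hcomm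
    refine ⟨Function.update x j b, hx, hxb, hba, hcomm ▸ ?_⟩
    have hg := Subgroup.subset_closure (show doubleSwap x i k a c ∈ {g : Perm (Fin n → A) |
        IsInstruction g ∧ g ∈ alternatingGroup (Fin n → A)} from
      ⟨isInstruction_doubleSwap .., doubleSwap_mem_alternatingGroup hik ha⟩)
    have hh := Subgroup.subset_closure (show doubleSwap x j l b d ∈ {g : Perm (Fin n → A) |
        IsInstruction g ∧ g ∈ alternatingGroup (Fin n → A)} from
      ⟨isInstruction_doubleSwap .., doubleSwap_mem_alternatingGroup hjl hb⟩)
    exact mul_mem (mul_mem (mul_mem hg hh) hg) hh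
end

section
/- Let A = Z_q with q ≥ 2 and n ≥ 2, let e^0 ∈ A^n be the all-zero state and, for k = 1, 2, let e^k ∈ A^n be the state with a 1 in coordinate k and 0 elsewhere. Let g be the 3-cycle (e^0, e^1, e^2), an even permutation of A^n. Then g can be written as a composition h_2 ∘ h_1 of two instructions (namely the transpositions (e^0,e^1) and (e^0,e^2)), but g cannot be written as a composition of two instructions each of which is an even permutation of A^n. Consequently, the alternating group Alt(A^n) is not fast. -/
/-- The transposition of two states that differ in at most one register is an instruction. -/
theorem isInstruction_swap_update {n : ℕ} {A : Type*} [DecidableEq (Fin n → A)]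
    (x : Fin n → A) (j : Fin n) (a : A) :
    IsInstruction (Equiv.swap x (Function.update x j a)) := by
  refine ⟨j, fun y i hi => ?_⟩
  rw [Equiv.swap_apply_def]
  split_ifs with h₁ h₂
  · rw [h₁, Function.update_of_ne hi]
  · rw [h₂, Function.update_of_ne hi]
  · rfl

/-- If `h₁` updates register `j₁` and `h₂` updates another register, then `h₁` is determined
by the composition `h₂ * h₁`. -/
theorem apply_eq_update_mul_apply {n : ℕ} {A : Type*} {h₁ h₂ : Equiv.Perm (Fin n → A)}
    {j₁ j₂ : Fin n} (hj : j₁ ≠ j₂)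
    (H₁ : ∀ (x : Fin n → A) (i : Fin n), i ≠ j₁ → h₁ x i = x i)
    (H₂ : ∀ (x : Fin n → A) (i : Fin n), i ≠ j₂ → h₂ x i = x i) (x : Fin n → A) :
    h₁ x = Function.update x j₁ ((h₂ * h₁) x j₁) := by
  refine Function.eq_update_iff.2 ⟨?_, fun i hi => H₁ x i hi⟩
  rw [Equiv.Perm.mul_apply, H₂ _ _ hj]

/-- Let `e0, e1, e2 ∈ (ℤ_q)^n` be the all-zero state and the first two unit
states, and let `g = (e0, e1, e2)` be the `3`-cycle, i.e. the composition
`(e0,e2) ∘ (e0,e1)`.  Then `g` is a composition of two instructions (namely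
the two transpositions `(e0,e1)` and `(e0,e2)`), but `g` is not a
composition of two instructions each of which is an even permutation.
Consequently the alternating group `Alt(A^n)` is not fast. -/
theorem alternating_not_fast
    (q n : ℕ) [NeZero q] (hq : 2 ≤ q) (hn : 2 ≤ n)
    (e0 e1 e2 : Fin n → ZMod q)
    (he0 : e0 = fun _ => 0)
    (he1 : e1 = Function.update (fun _ => (0 : ZMod q)) ⟨0, by omega⟩ 1)
    (he2 : e2 = Function.update (fun _ => (0 : ZMod q)) ⟨1, by omega⟩ 1) :
    (IsInstruction (Equiv.swap e0 e1) ∧ IsInstruction (Equiv.swap e0 e2) ∧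
      ∃ h₁ h₂ : Equiv.Perm (Fin n → ZMod q),
        IsInstruction h₁ ∧ IsInstruction h₂ ∧
        Equiv.swap e0 e2 * Equiv.swap e0 e1 = h₂ * h₁) ∧
    ¬ ∃ h₁ h₂ : Equiv.Perm (Fin n → ZMod q),
        IsInstruction h₁ ∧ h₁ ∈ alternatingGroup (Fin n → ZMod q) ∧
        IsInstruction h₂ ∧ h₂ ∈ alternatingGroup (Fin n → ZMod q) ∧
        Equiv.swap e0 e2 * Equiv.swap e0 e1 = h₂ * h₁ := by
  have : Fact (1 < q) := ⟨hq⟩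
  have i01 : IsInstruction (Equiv.swap e0 e1) := by
    rw [he1, he0]; exact isInstruction_swap_update _ _ _
  have i02 : IsInstruction (Equiv.swap e0 e2) := by
    rw [he2, he0]; exact isInstruction_swap_update _ _ _
  refine ⟨⟨i01, i02, _, _, i01, i02, rfl⟩, ?_⟩
  rintro ⟨h₁, h₂, ⟨j₁, H₁⟩, h₁_even, ⟨j₂, H₂⟩, -, hg⟩
  obtain ⟨a, ha⟩ : ∃ a : Fin n, a = ⟨0, by omega⟩ := ⟨_, rfl⟩
  obtain ⟨b, hb⟩ : ∃ b : Fin n, b = ⟨1, by omega⟩ := ⟨_, rfl⟩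
  have hab : a ≠ b := by simp [ha, hb]
  rw [← ha] at he1
  rw [← hb] at he2
  have e0_apply (i : Fin n) : e0 i = 0 := by rw [he0]
  have e1_a : e1 a = 1 := by simp [he1]
  have e1_of_ne {i : Fin n} (hi : i ≠ a) : e1 i = 0 := by simp [he1, hi]
  have e2_b : e2 b = 1 := by simp [he2]
  have e2_of_ne {i : Fin n} (hi : i ≠ b) : e2 i = 0 := by simp [he2, hi]
  have h01 : e0 ≠ e1 := fun h => by simpa [e0_apply, e1_a] using congrFun h a
  have h02 : e0 ≠ e2 := fun h => by simpa [e0_apply, e2_b] using congrFun h b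
  have h12 : e1 ≠ e2 := fun h => by simpa [e1_a, e2_of_ne hab] using congrFun h a
  have g0 : (h₂ * h₁) e0 = e1 := by
    simp [← hg, Equiv.swap_apply_of_ne_of_ne h01.symm h12]
  have g1 : (h₂ * h₁) e1 = e2 := by simp [← hg]
  have g2 : (h₂ * h₁) e2 = e0 := by
    simp [← hg, Equiv.swap_apply_of_ne_of_ne h02.symm h12.symm]
  have g_of_ne {x : Fin n → ZMod q} (hx0 : x ≠ e0) (hx1 : x ≠ e1) (hx2 : x ≠ e2) :
      (h₂ * h₁) x = x := by
    simp [← hg, Equiv.swap_apply_of_ne_of_ne, hx0, hx1, hx2]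
  have g_apply_of_ne (x : Fin n → ZMod q) {i : Fin n} (hi₁ : i ≠ j₁) (hi₂ : i ≠ j₂) :
      (h₂ * h₁) x i = x i := by
    rw [Equiv.Perm.mul_apply, H₂ _ _ hi₂, H₁ _ _ hi₁]
  have ha_mem : a = j₁ ∨ a = j₂ := by
    by_contra! h
    have := g_apply_of_ne e1 h.1 h.2
    simp [g1, e1_a, e2_of_ne hab] at this
  have hb_mem : b = j₁ ∨ b = j₂ := by
    by_contra! h
    have := g_apply_of_ne e1 h.1 h.2
    simp [g1, e2_b, e1_of_ne hab.symm] at this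
  have hj : j₁ ≠ j₂ := by grind
  have key := apply_eq_update_mul_apply hj H₁ H₂
  rcases ha_mem with rfl | rfl
  · have h₁_eq : h₁ = Equiv.swap e0 e1 := by
      ext1 x
      rw [key x]
      by_cases hx0 : x = e0
      · rw [hx0, g0, Equiv.swap_apply_left, e1_a, he0, he1]
      by_cases hx1 : x = e1
      · rw [hx1, g1, Equiv.swap_apply_right, e2_of_ne hab, he1, he0, Function.update_idem]
        exact Function.update_eq_self _ _
      rw [Equiv.swap_apply_of_ne_of_ne hx0 hx1]
      by_cases hx2 : x = e2
      · rw [hx2, g2, e0_apply, ← e2_of_ne hab, Function.update_eq_self]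
      · rw [g_of_ne hx0 hx1 hx2, Function.update_eq_self]
    rw [h₁_eq, Equiv.Perm.mem_alternatingGroup, Equiv.Perm.sign_swap h01] at h₁_even
    exact absurd h₁_even (by decide)
  · obtain rfl : b = j₁ := hb_mem.resolve_right hab.symm
    -- Here `h₁` sends `e1` to `e1 + e2`, which it must also fix.
    obtain ⟨y, hy⟩ : ∃ y, y = Function.update e1 b 1 := ⟨_, rfl⟩
    have y_b : y b = 1 := by simp [hy]
    have y_a : y a = 1 := by simp [hy, hab, e1_a]
    have hy0 : y ≠ e0 := fun h => by simpa [y_b, e0_apply] using congrFun h b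
    have hy1 : y ≠ e1 := fun h => by simpa [y_b, e1_of_ne hab.symm] using congrFun h b
    have hy2 : y ≠ e2 := fun h => by simpa [y_a, e2_of_ne hab] using congrFun h a
    have h₁_e1 : h₁ e1 = y := by rw [key, g1, e2_b, hy]
    have h₁_y : h₁ y = y := by rw [key, g_of_ne hy0 hy1 hy2, Function.update_eq_self]
    exact hy1 (h₁.injective (h₁_y.trans h₁_e1.symm))
end
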